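/- Let a, μ ∈ (0, π) and σ > 0, and let X = μ + ω where ω is a real Gaussian random variable with mean 0 and variance σ². With F_M the Fejér kernel F_M(x) = (1/M)·(sin(Mπx/2)/sin(πx/2))² for x not an even integer and F_M(x) = M otherwise, one has lim_{M→∞} E[ F_M( cos a − cos X ) ] = I(a, μ, σ²), where I(x, y, z) = (2/√(2π·z·sin²x)) · ∑_{i ∈ ℤ} ( exp(−(2iπ + x − y)²/(2z)) + exp(−(2(i+1)π − x − y)²/(2z)) ). -/

import Mathlib

open MeasureTheory ProbabilityTheory Filter
open scoped Classical

/-- The Fejér kernel: `F_M(x) = (1/M)·(sin(Mπx/2)/sin(πx/2))²` for `x` not an even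
integer, and `F_M(x) = M` for `x` an even integer. -/
noncomputable def fejer (M : ℕ) (x : ℝ) : ℝ :=
  if ∃ k : ℤ, x = 2 * k then (M : ℝ)
  else (1 / M) * (Real.sin (M * Real.pi * x / 2) / Real.sin (Real.pi * x / 2)) ^ 2

/-- The interference factor `I(x, y, z)` of Lemma 5 of the paper. -/
noncomputable def Ifun (x y z : ℝ) : ℝ :=
  (2 / Real.sqrt (2 * Real.pi * z * (Real.sin x) ^ 2)) *
    ∑' i : ℤ, (Real.exp (-(2 * (i : ℝ) * Real.pi + x - y) ^ 2 / (2 * z)) +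
      Real.exp (-(2 * ((i : ℝ) + 1) * Real.pi - x - y) ^ 2 / (2 * z)))

/-- The Fejér kernel of order `M`, multiplied by `M`, as a cosine polynomial. -/
noncomputable def fejerSum (M : ℕ) (x : ℝ) : ℝ :=
  ∑ j ∈ Finset.range M, (1 + 2 * ∑ k ∈ Finset.range j, Real.cos ((k + 1 : ℝ) * Real.pi * x))

lemma sin_mul_dirichlet (j : ℕ) (y : ℝ) :
    Real.sin y * (1 + 2 * ∑ k ∈ Finset.range j, Real.cos ((k + 1 : ℝ) * (2 * y))) =
      Real.sin ((2 * j + 1) * y) := by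
  induction j with
  | zero => simp
  | succ j ih =>
    have h1 : ((2 * ((j + 1 : ℕ) : ℝ) + 1) * y) = ((j : ℝ) + 1) * (2 * y) + y := by
      push_cast; ring
    have h2 : ((2 * (j : ℝ) + 1) * y) = ((j : ℝ) + 1) * (2 * y) - y := by ring
    rw [Finset.sum_range_succ, h1, Real.sin_add]
    rw [h2, Real.sin_sub] at ih
    linear_combination ih

lemma sin_mul_sum_sin_odd (M : ℕ) (y : ℝ) :
    Real.sin y * ∑ j ∈ Finset.range M, Real.sin ((2 * j + 1) * y) = Real.sin (M * y) ^ 2 := by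
  induction M with
  | zero => simp
  | succ M ih =>
    have h1 : (2 * (M : ℝ) + 1) * y = M * y + (M * y + y) := by ring
    have h2 : ((M + 1 : ℕ) : ℝ) * y = M * y + y := by push_cast; ring
    rw [Finset.sum_range_succ, mul_add, ih, h1, h2]
    simp only [Real.sin_add, Real.cos_add]
    have h4 := Real.sin_sq_add_cos_sq y
    linear_combination (-(Real.sin (M * y) ^ 2)) * h4

lemma sin_sq_mul_fejerSum (M : ℕ) (x : ℝ) :
    Real.sin (Real.pi * x / 2) ^ 2 * fejerSum M x = Real.sin (M * (Real.pi * x / 2)) ^ 2 := by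
  rw [← sin_mul_sum_sin_odd, fejerSum, sq, mul_assoc, Finset.mul_sum]
  congr 1
  refine Finset.sum_congr rfl fun j _ => ?_
  rw [← sin_mul_dirichlet]
  congr 4 with k
  ring_nf

lemma fejerSum_two_mul_int (M : ℕ) (n : ℤ) : fejerSum M (2 * n) = (M : ℝ) ^ 2 := by
  have h (k : ℕ) : Real.cos ((k + 1 : ℝ) * Real.pi * (2 * n)) = 1 := by
    have := Real.cos_int_mul_two_pi ((k + 1) * n)
    push_cast at this
    refine Eq.trans ?_ this
    congr 1
    ring
  simp only [fejerSum, h]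
  induction M with
  | zero => simp
  | succ M ih => rw [Finset.sum_range_succ, ih]; simp; ring

lemma fejer_eq_fejerSum {M : ℕ} (hM : 0 < M) (x : ℝ) : fejer M x = fejerSum M x / M := by
  have hM' : (M : ℝ) ≠ 0 := by positivity
  unfold fejer
  split_ifs with h
  · obtain ⟨k, rfl⟩ := h
    rw [fejerSum_two_mul_int]
    field_simp
  · have hs : Real.sin (Real.pi * x / 2) ≠ 0 := by
      intro h0
      obtain ⟨k, hk⟩ := Real.sin_eq_zero_iff.1 h0
      refine h ⟨k, ?_⟩
      have := Real.pi_ne_zero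
      field_simp at hk
      linarith
    have := sin_sq_mul_fejerSum M x
    rw [show (M : ℝ) * Real.pi * x / 2 = M * (Real.pi * x / 2) by ring, div_pow, ← this]
    field_simp

lemma fejer_nonneg (M : ℕ) (x : ℝ) : 0 ≤ fejer M x := by
  unfold fejer
  split_ifs <;> positivity

lemma continuous_fejer {M : ℕ} (hM : 0 < M) : Continuous (fejer M) := by
  rw [funext (fejer_eq_fejerSum hM)]
  unfold fejerSum
  fun_prop

lemma fejer_mul_sin_sq_le {M : ℕ} (hM : 0 < M) (x : ℝ) :
    fejer M x * Real.sin (Real.pi * x / 2) ^ 2 ≤ 1 / M := by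
  rw [fejer_eq_fejerSum hM, div_mul_eq_mul_div, mul_comm, sin_sq_mul_fejerSum]
  gcongr
  exact Real.sin_sq_le_one _

lemma integral_fejer_period {M : ℕ} (hM : 0 < M) (c : ℝ) :
    ∫ x in (c - 1)..(c + 1), fejer M x = 2 := by
  have hM' : (M : ℝ) ≠ 0 := by positivity
  have hcos (k : ℕ) : ∫ x in (c - 1)..(c + 1), Real.cos ((k + 1 : ℝ) * Real.pi * x) = 0 := by
    have hk : (k + 1 : ℝ) * Real.pi ≠ 0 := by positivity
    rw [intervalIntegral.integral_comp_mul_left _ hk, integral_cos,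
      show (k + 1 : ℝ) * Real.pi * (c + 1) =
        (k + 1 : ℝ) * Real.pi * (c - 1) + (k + 1 : ℕ) * (2 * Real.pi) by push_cast; ring,
      Real.sin_add_nat_mul_two_pi]
    simp
  have hsum : ∫ x in (c - 1)..(c + 1), fejerSum M x = M * 2 := by
    unfold fejerSum
    rw [intervalIntegral.integral_finsetSum]
    · have (j : ℕ) : ∫ x in (c - 1)..(c + 1),
          (1 + 2 * ∑ k ∈ Finset.range j, Real.cos ((k + 1 : ℝ) * Real.pi * x)) = 2 := by
        rw [intervalIntegral.integral_add, intervalIntegral.integral_const_mul,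
          intervalIntegral.integral_finsetSum]
        · simp only [hcos, intervalIntegral.integral_const]
          norm_num
        all_goals intros; apply Continuous.intervalIntegrable; fun_prop
      simp [this]
    · intros; apply Continuous.intervalIntegrable; fun_prop
  rw [funext (fejer_eq_fejerSum hM), intervalIntegral.integral_div, hsum]
  field_simp

lemma integral_fejer_cos_sub_cos_mul_sin {M : ℕ} (hM : 0 < M) (a : ℝ) :
    ∫ t in 0..Real.pi, fejer M (Real.cos a - Real.cos t) * Real.sin t = 2 := by
  have h := intervalIntegral.integral_comp_mul_deriv (a := 0) (b := Real.pi)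
    (f := fun t => Real.cos a - Real.cos t) (f' := Real.sin) (g := fejer M)
    (fun t _ => by simpa using (Real.hasDerivAt_cos t).const_sub (Real.cos a))
    Real.continuous_sin.continuousOn (continuous_fejer hM)
  simp only [Function.comp_apply, Real.cos_zero, Real.cos_pi, sub_neg_eq_add] at h
  rw [h, integral_fejer_period hM]

lemma sin_pi_mul_cos_sub_cos_ne_zero {a t : ℝ} (ha : a ∈ Set.Ioo 0 Real.pi)
    (ht : t ∈ Set.Icc 0 Real.pi) (hta : t ≠ a) :
    Real.sin (Real.pi * (Real.cos a - Real.cos t) / 2) ≠ 0 := by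
  have hne : Real.cos a ≠ Real.cos t := fun h =>
    hta (Real.injOn_cos ht (Set.Ioo_subset_Icc_self ha) h.symm)
  have h1 : Real.cos a < 1 := by
    simpa using Real.cos_lt_cos_of_nonneg_of_le_pi le_rfl ha.2.le ha.1
  have h2 : -1 < Real.cos a := by
    simpa using Real.cos_lt_cos_of_nonneg_of_le_pi ha.1.le le_rfl ha.2
  have h3 := Real.cos_le_one t
  have h4 := Real.neg_one_le_cos t
  have hpi := Real.pi_pos
  rw [Ne, Real.sin_eq_zero_iff_of_lt_of_lt (by nlinarith) (by nlinarith)]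
  intro h
  rcases div_eq_zero_iff.1 h with h | h
  · rcases mul_eq_zero.1 h with h | h
    · exact hpi.ne' h
    · exact hne (sub_eq_zero.1 h)
  · norm_num at h

/-- A continuous function vanishing at `a` is controlled by a small multiple of `sin` and a
large multiple of the squared sine in the denominator of the Fejér kernel. -/
lemma exists_abs_le_mul_sin_add {a : ℝ} (ha : a ∈ Set.Ioo 0 Real.pi) {r : ℝ → ℝ}
    (hr : Continuous r) (hra : r a = 0) {ε : ℝ} (hε : 0 < ε) :
    ∃ C, 0 ≤ C ∧ ∀ t ∈ Set.Icc 0 Real.pi, |r t| ≤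
      ε * Real.sin t + C * Real.sin (Real.pi * (Real.cos a - Real.cos t) / 2) ^ 2 := by
  set s : ℝ → ℝ := fun t => Real.sin (Real.pi * (Real.cos a - Real.cos t) / 2) ^ 2
  have hscont : Continuous s := by fun_prop
  set K : Set ℝ := Set.Icc 0 Real.pi ∩ {t | ε * Real.sin t ≤ |r t|}
  have hKc : IsCompact K := isCompact_Icc.inter_right
    (isClosed_le (by fun_prop) (by fun_prop))
  have hsK : ∀ t ∈ K, s t ≠ 0 := by
    intro t ht
    refine pow_ne_zero 2 (sin_pi_mul_cos_sub_cos_ne_zero ha ht.1 ?_)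
    rintro rfl
    have h1 : ε * Real.sin t ≤ |r t| := ht.2
    rw [hra, abs_zero] at h1
    exact absurd h1 (not_le.2 (mul_pos hε (Real.sin_pos_of_mem_Ioo ha)))
  obtain ⟨C, hC⟩ := hKc.exists_bound_of_continuousOn
    (hr.continuousOn.div hscont.continuousOn hsK)
  refine ⟨max C 0, le_max_right _ _, fun t ht => ?_⟩
  have hs0 : 0 ≤ s t := sq_nonneg _
  by_cases htK : t ∈ K
  · have h1 := hC t htK
    rw [Pi.div_apply, norm_div, Real.norm_eq_abs, Real.norm_eq_abs, abs_of_nonneg hs0,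
      div_le_iff₀ (lt_of_le_of_ne hs0 (hsK t htK).symm)] at h1
    have h2 : C * s t ≤ max C 0 * s t := by gcongr; exact le_max_left _ _
    have h3 : 0 ≤ ε * Real.sin t := mul_nonneg hε.le (Real.sin_nonneg_of_mem_Icc ht)
    change |r t| ≤ ε * Real.sin t + max C 0 * s t
    linarith
  · have h1 : |r t| < ε * Real.sin t := by
      by_contra! h
      exact htK ⟨ht, h⟩
    have h2 : 0 ≤ max C 0 * s t := by positivity
    change |r t| ≤ ε * Real.sin t + max C 0 * s t
    linarith

lemma tendsto_integral_fejer_mul_of_eq_zero {a : ℝ} (ha : a ∈ Set.Ioo 0 Real.pi) {r : ℝ → ℝ}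
    (hr : Continuous r) (hra : r a = 0) :
    Tendsto (fun M : ℕ => ∫ t in 0..Real.pi, fejer M (Real.cos a - Real.cos t) * r t)
      atTop (nhds 0) := by
  rw [Metric.tendsto_atTop]
  intro ε hε
  obtain ⟨C, hC0, hC⟩ := exists_abs_le_mul_sin_add ha hr hra (ε := ε / 4) (by positivity)
  have hlim : Tendsto (fun M : ℕ => Real.pi * C * (1 / (M : ℝ))) atTop (nhds 0) := by
    simpa using (tendsto_one_div_atTop_nhds_zero_nat (𝕜 := ℝ)).const_mul (Real.pi * C)
  obtain ⟨N, hN⟩ := eventually_atTop.1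
    ((hlim.eventually_lt_const (half_pos hε)).and (eventually_gt_atTop 0))
  refine ⟨N, fun M hNM => ?_⟩
  obtain ⟨hlt, hM⟩ := hN M hNM
  have hF : Continuous fun t => fejer M (Real.cos a - Real.cos t) :=
    (continuous_fejer hM).comp (by fun_prop)
  have hbound : ∀ t ∈ Set.Ioc 0 Real.pi, ‖fejer M (Real.cos a - Real.cos t) * r t‖ ≤
      ε / 4 * (fejer M (Real.cos a - Real.cos t) * Real.sin t) + C * (1 / (M : ℝ)) := by
    intro t ht
    have h0 := fejer_nonneg M (Real.cos a - Real.cos t)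
    have h1 := mul_le_mul_of_nonneg_left (hC t (Set.Ioc_subset_Icc_self ht)) h0
    have h2 := mul_le_mul_of_nonneg_left
      (fejer_mul_sin_sq_le hM (Real.cos a - Real.cos t)) hC0
    rw [norm_mul, Real.norm_eq_abs, Real.norm_eq_abs, abs_of_nonneg h0]
    linarith
  rw [dist_zero_right]
  calc ‖∫ t in 0..Real.pi, fejer M (Real.cos a - Real.cos t) * r t‖
      ≤ ∫ t in 0..Real.pi, (ε / 4 * (fejer M (Real.cos a - Real.cos t) * Real.sin t) +
          C * (1 / (M : ℝ))) :=
        intervalIntegral.norm_integral_le_of_norm_le Real.pi_pos.le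
          (Eventually.of_forall hbound)
          (Continuous.intervalIntegrable (by fun_prop) _ _)
    _ = ε / 2 + Real.pi * C * (1 / (M : ℝ)) := by
        rw [intervalIntegral.integral_add, intervalIntegral.integral_const_mul,
          integral_fejer_cos_sub_cos_mul_sin hM, intervalIntegral.integral_const]
        · simp only [smul_eq_mul]; ring
        all_goals apply Continuous.intervalIntegrable; fun_prop
    _ < ε := by linarith

lemma tendsto_integral_fejer_mul {a : ℝ} (ha : a ∈ Set.Ioo 0 Real.pi) {h : ℝ → ℝ}
    (hh : Continuous h) :
    Tendsto (fun M : ℕ => ∫ t in 0..Real.pi, fejer M (Real.cos a - Real.cos t) * h t)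
      atTop (nhds (2 / Real.sin a * h a)) := by
  have hsin : Real.sin a ≠ 0 := (Real.sin_pos_of_mem_Ioo ha).ne'
  have key := (tendsto_integral_fejer_mul_of_eq_zero ha
    (r := fun t => h t - h a / Real.sin a * Real.sin t) (by fun_prop)
    (by field_simp; ring)).add_const (2 / Real.sin a * h a)
  rw [zero_add] at key
  refine key.congr' ?_
  filter_upwards [eventually_gt_atTop 0] with M hM
  have hF : Continuous fun t => fejer M (Real.cos a - Real.cos t) :=
    (continuous_fejer hM).comp (by fun_prop)
  have : ∀ t, fejer M (Real.cos a - Real.cos t) * (h t - h a / Real.sin a * Real.sin t) =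
      fejer M (Real.cos a - Real.cos t) * h t -
        h a / Real.sin a * (fejer M (Real.cos a - Real.cos t) * Real.sin t) := fun t => by ring
  simp only [this]
  rw [intervalIntegral.integral_sub, intervalIntegral.integral_const_mul,
    integral_fejer_cos_sub_cos_mul_sin hM]
  · ring
  all_goals apply Continuous.intervalIntegrable; fun_prop

/-- Folding an integral over the line against an even `2π`-periodic function onto `[0, π]`. -/
lemma hasSum_integral_fold {g f : ℝ → ℝ} (hg : Continuous g) (hf : Continuous f)
    (hper : ∀ (n : ℤ) t, g (2 * Real.pi * n + t) = g t) (heven : ∀ t, g (-t) = g t)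
    (hInt : Integrable fun x => g x * f x) :
    HasSum (fun n : ℤ => ∫ t in 0..Real.pi,
      g t * (f (2 * Real.pi * n + t) + f (2 * Real.pi * (n + 1) - t)))
      (∫ x, g x * f x) := by
  have hpi : (2 * Real.pi) ≠ 0 := by positivity
  have h1 := ((hInt.comp_mul_left' hpi).hasSum_intervalIntegral 0).mul_left (2 * Real.pi)
  rw [Measure.integral_comp_mul_left (fun x => g x * f x), abs_of_pos (by positivity),
    smul_eq_mul, mul_inv_cancel_left₀ hpi] at h1
  refine (congrArg (HasSum · _) (funext fun n => ?_)).mpr h1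
  have hG : Continuous fun x => g x * f x := hg.mul hf
  have hleft (t : ℝ) : g t * f (2 * Real.pi * n + t) =
      g (2 * Real.pi * n + t) * f (2 * Real.pi * n + t) := by rw [hper]
  have hright (t : ℝ) : g t * f (2 * Real.pi * (n + 1) - t) =
      g (2 * Real.pi * (n + 1) - t) * f (2 * Real.pi * (n + 1) - t) := by
    have := hper (n + 1) (-t)
    push_cast at this
    rw [sub_eq_add_neg, this, heven]
  simp only [mul_add (g _)]
  rw [intervalIntegral.integral_add]
  · simp only [hleft, hright]
    rw [intervalIntegral.integral_comp_add_left (fun x => g x * f x),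
      intervalIntegral.integral_comp_sub_left (fun x => g x * f x),
      intervalIntegral.mul_integral_comp_mul_left (f := fun x => g x * f x),
      show 2 * Real.pi * (n + 1 : ℝ) - Real.pi = 2 * Real.pi * n + Real.pi by ring,
      intervalIntegral.integral_add_adjacent_intervals (hG.intervalIntegrable _ _)
        (hG.intervalIntegrable _ _)]
    congr 1 <;> ring
  all_goals apply Continuous.intervalIntegrable; fun_prop

lemma summable_pow_natAbs {q : ℝ} (h0 : 0 ≤ q) (h1 : q < 1) :
    Summable fun n : ℤ => q ^ n.natAbs :=
  Summable.of_nat_of_neg (by simpa using summable_geometric_of_lt_one h0 h1)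
    (by simpa using summable_geometric_of_lt_one h0 h1)

lemma exp_neg_sq_le {z s : ℝ} (hz : 0 < z) (hs : |s| ≤ 2 * Real.pi) (n : ℤ) :
    Real.exp (-(2 * Real.pi * n + s) ^ 2 / (2 * z)) ≤
      Real.exp (2 * Real.pi ^ 2 / z) * Real.exp (-Real.pi ^ 2 / z) ^ n.natAbs := by
  rw [← Real.exp_nat_mul, ← Real.exp_add]
  gcongr
  have hn : ((n.natAbs : ℕ) : ℝ) ≤ (n : ℝ) ^ 2 := by
    have : ((n.natAbs : ℕ) : ℝ) ≤ ((n.natAbs : ℕ) : ℝ) ^ 2 := by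
      exact_mod_cast Nat.le_self_pow two_ne_zero _
    simpa using this
  have hs2 : s ^ 2 ≤ (2 * Real.pi) ^ 2 := sq_le_sq' (by linarith [neg_abs_le s])
    ((le_abs_self s).trans hs)
  have h3 : Real.pi ^ 2 * ((n.natAbs : ℕ) : ℝ) ≤ Real.pi ^ 2 * (n : ℝ) ^ 2 := by gcongr
  have h4 := sq_nonneg (2 * Real.pi * n + 2 * s)
  rw [div_le_iff₀ (by positivity)]
  field_simp
  nlinarith

lemma norm_integral_fejer_mul_le {M : ℕ} (hM : 0 < M) (a : ℝ) {h : ℝ → ℝ} {B : ℝ}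
    (hB : ∀ t ∈ Set.Icc 0 Real.pi, |h t| ≤ B) :
    ‖∫ t in 0..Real.pi, fejer M (Real.cos a - Real.cos t) * h t‖ ≤
      (∫ t in 0..Real.pi, fejer M (Real.cos a - Real.cos t) * 1) * B := by
  have hF : Continuous fun t => fejer M (Real.cos a - Real.cos t) :=
    (continuous_fejer hM).comp (by fun_prop)
  rw [← intervalIntegral.integral_mul_const]
  refine intervalIntegral.norm_integral_le_of_norm_le Real.pi_pos.le
    (Eventually.of_forall fun t ht => ?_) (Continuous.intervalIntegrable (by fun_prop) _ _)
  have h0 := fejer_nonneg M (Real.cos a - Real.cos t)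
  rw [norm_mul, Real.norm_eq_abs, Real.norm_eq_abs, abs_of_nonneg h0, mul_one]
  exact mul_le_mul_of_nonneg_left (hB t (Set.Ioc_subset_Icc_self ht)) h0

lemma exists_norm_fejer_cos_sub_cos_le {M : ℕ} (hM : 0 < M) (a : ℝ) :
    ∃ C, ∀ x, ‖fejer M (Real.cos a - Real.cos x)‖ ≤ C := by
  obtain ⟨C, hC⟩ := (isCompact_Icc (a := (-2 : ℝ)) (b := 2)).exists_bound_of_continuousOn
    (continuous_fejer hM).continuousOn
  refine ⟨C, fun x => hC _ ⟨?_, ?_⟩⟩ <;>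
  linarith [Real.cos_le_one a, Real.neg_one_le_cos a, Real.cos_le_one x, Real.neg_one_le_cos x]

lemma hasSum_integral_gaussianReal_fejer {M : ℕ} (hM : 0 < M) (a μ : ℝ) {v : NNReal}
    (hv : v ≠ 0) :
    HasSum (fun n : ℤ => ∫ t in 0..Real.pi, fejer M (Real.cos a - Real.cos t) *
      (gaussianPDFReal μ v (2 * Real.pi * n + t) +
        gaussianPDFReal μ v (2 * Real.pi * (n + 1) - t)))
      (∫ ω, fejer M (Real.cos a - Real.cos (μ + ω)) ∂(gaussianReal 0 v)) := by
  have hF : Continuous fun t => fejer M (Real.cos a - Real.cos t) :=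
    (continuous_fejer hM).comp (by fun_prop)
  have hpdf : Continuous (gaussianPDFReal μ v) := by
    rw [gaussianPDFReal_def]; fun_prop
  obtain ⟨C, hC⟩ := exists_norm_fejer_cos_sub_cos_le hM a
  have hInt : Integrable fun x => fejer M (Real.cos a - Real.cos x) * gaussianPDFReal μ v x :=
    (integrable_gaussianPDFReal μ v).bdd_mul hF.aestronglyMeasurable (Eventually.of_forall hC)
  have hmean : ∫ ω, fejer M (Real.cos a - Real.cos (μ + ω)) ∂(gaussianReal 0 v) =
      ∫ x, fejer M (Real.cos a - Real.cos x) * gaussianPDFReal μ v x := by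
    rw [integral_gaussianReal_eq_integral_smul hv,
      ← integral_add_left_eq_self
        (fun x => fejer M (Real.cos a - Real.cos x) * gaussianPDFReal μ v x) μ]
    refine integral_congr_ae (Eventually.of_forall fun x => ?_)
    simp [gaussianPDFReal, mul_comm]
  rw [hmean]
  refine hasSum_integral_fold hF hpdf (fun n t => ?_) (fun t => by simp) hInt
  rw [show 2 * Real.pi * n + t = t + n * (2 * Real.pi) by ring, Real.cos_add_int_mul_two_pi]

/-- A bound for the wrapped Gaussian density at level `n`, summable in `n`. -/
lemma abs_gaussianPDFReal_add_le {μ : ℝ} (hμ : μ ∈ Set.Ioo 0 Real.pi) {v : NNReal}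
    (hv : v ≠ 0) (n : ℤ) {t : ℝ} (ht : t ∈ Set.Icc 0 Real.pi) :
    |gaussianPDFReal μ v (2 * Real.pi * n + t) +
        gaussianPDFReal μ v (2 * Real.pi * (n + 1) - t)| ≤
      2 * (Real.sqrt (2 * Real.pi * v))⁻¹ * Real.exp (2 * Real.pi ^ 2 / v) *
        Real.exp (-Real.pi ^ 2 / v) ^ n.natAbs := by
  obtain ⟨hμ0, hμ1⟩ := hμ
  obtain ⟨ht0, ht1⟩ := ht
  have hv' : 0 < (v : ℝ) := by positivity
  have h1 := exp_neg_sq_le hv' (s := t - μ) (abs_le.2 ⟨by linarith, by linarith⟩) n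
  have h2 := exp_neg_sq_le hv' (s := 2 * Real.pi - t - μ)
    (abs_le.2 ⟨by linarith, by linarith⟩) n
  rw [abs_of_nonneg (add_nonneg (gaussianPDFReal_nonneg _ _ _) (gaussianPDFReal_nonneg _ _ _)),
    gaussianPDFReal, gaussianPDFReal, ← mul_add,
    show 2 * Real.pi * n + t - μ = 2 * Real.pi * n + (t - μ) by ring,
    show 2 * Real.pi * (n + 1) - t - μ = 2 * Real.pi * n + (2 * Real.pi - t - μ) by ring]
  have h3 := mul_le_mul_of_nonneg_left (add_le_add h1 h2)
    (inv_nonneg.2 (Real.sqrt_nonneg (2 * Real.pi * v)))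
  linarith

lemma tsum_gaussianPDFReal_eq_Ifun {a : ℝ} (ha : a ∈ Set.Ioo 0 Real.pi) (μ : ℝ) (v : NNReal) :
    ∑' n : ℤ, 2 / Real.sin a * (gaussianPDFReal μ v (2 * Real.pi * n + a) +
      gaussianPDFReal μ v (2 * Real.pi * (n + 1) - a)) = Ifun a μ v := by
  rw [Ifun, ← tsum_mul_left]
  refine tsum_congr fun n => ?_
  rw [Real.sqrt_mul (by positivity), Real.sqrt_sq (Real.sin_pos_of_mem_Ioo ha).le,
    gaussianPDFReal, gaussianPDFReal,
    show 2 * Real.pi * n + a - μ = 2 * n * Real.pi + a - μ by ring,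
    show 2 * Real.pi * (n + 1) - a - μ = 2 * (n + 1) * Real.pi - a - μ by ring,
    ← div_div]
  ring

/-- Lemma 5 (Appendix F): for `X = μ + ω` with `ω ~ N(0, σ²)`,
`lim_{M→∞} E[F_M(cos a − cos X)] = I(a, μ, σ²)`. -/
theorem stmt16 (a μ σ : ℝ) (ha : a ∈ Set.Ioo 0 Real.pi) (hμ : μ ∈ Set.Ioo 0 Real.pi)
    (hσ : 0 < σ) :
    Tendsto (fun M : ℕ =>
        ∫ ω, fejer M (Real.cos a - Real.cos (μ + ω))
          ∂(gaussianReal 0 ⟨σ ^ 2, sq_nonneg σ⟩))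
      atTop (nhds (Ifun a μ (σ ^ 2))) := by
  let v : NNReal := ⟨σ ^ 2, sq_nonneg σ⟩
  have hv : v ≠ 0 := by
    intro h
    have : σ ^ 2 = 0 := congrArg NNReal.toReal h
    exact (pow_pos hσ 2).ne' this
  have hv' : 0 < (v : ℝ) := by positivity
  have hpdf : Continuous (gaussianPDFReal μ v) := by
    rw [gaussianPDFReal_def]; fun_prop
  change Tendsto _ atTop (nhds (Ifun a μ v))
  rw [← tsum_gaussianPDFReal_eq_Ifun ha μ v]
  set D : ℝ := 2 / Real.sin a * 1 + 1
  have hlim := tendsto_integral_fejer_mul ha (continuous_const (y := (1 : ℝ)))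
  have hq : Real.exp (-Real.pi ^ 2 / v) < 1 := by
    rw [Real.exp_lt_one_iff, neg_div, neg_lt_zero]
    positivity
  have key := tendsto_tsum_of_dominated_convergence
    (f := fun (M : ℕ) (n : ℤ) => ∫ t in 0..Real.pi, fejer M (Real.cos a - Real.cos t) *
      (gaussianPDFReal μ v (2 * Real.pi * n + t) +
        gaussianPDFReal μ v (2 * Real.pi * (n + 1) - t)))
    (((summable_pow_natAbs (Real.exp_nonneg _) hq).mul_left
      (2 * (Real.sqrt (2 * Real.pi * v))⁻¹ * Real.exp (2 * Real.pi ^ 2 / v))).mul_left D)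
    (fun n => tendsto_integral_fejer_mul ha
      (h := fun t => gaussianPDFReal μ v (2 * Real.pi * n + t) +
        gaussianPDFReal μ v (2 * Real.pi * (n + 1) - t)) (by fun_prop)) (by
      filter_upwards [hlim.eventually_lt_const (lt_add_one _), eventually_gt_atTop 0]
        with M hlt hM n
      refine (norm_integral_fejer_mul_le hM a
        fun t ht => abs_gaussianPDFReal_add_le hμ hv n ht).trans ?_
      exact mul_le_mul_of_nonneg_right hlt.le (by positivity))
  refine key.congr' ?_
  filter_upwards [eventually_gt_atTop 0] with M hM
  exact (hasSum_integral_gaussianReal_fejer hM a μ hv).tsum_eq
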